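/- Let p be a pattern with reversal over an alphabet Σ of exactly n variables. If the length of p is at least 2^n, then p is avoidable. -/

import Mathlib

/-!
Formalization framework: a variable alphabet `Σ` is a type `V`; the letter
`(x, false)` represents the variable `x` and `(x, true)` represents its mirror
image `x^R`.  A pattern with reversal is a `List (V × Bool)`, and a formula
with reversal is a set of such patterns (finiteness and nonemptiness of
fragments are taken as hypotheses where relevant).  A morphism respecting
reversal is determined by its values `h : V → List A` on plain variables.
-/

/-- The image of a pattern with reversal under the reversal-respecting extension of `h`. -/
def applyRev {V A : Type*} (h : V → List A) (p : List (V × Bool)) : List A :=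
  p.flatMap fun z => if z.2 then (h z.1).reverse else h z.1

/-- A morphism is non-erasing if it sends no variable to the empty word. -/
def NonErasing {V A : Type*} (h : V → List A) : Prop := ∀ x, h x ≠ []

/-- A formula with reversal `φ` occurs in a finite word `w`. -/
def OccursIn {V A : Type*} (φ : Set (List (V × Bool))) (w : List A) : Prop :=
  ∃ h : V → List A, NonErasing h ∧ ∀ p ∈ φ, applyRev h p <:+: w

/-- A formula with reversal is avoidable: over some finite alphabet,
infinitely many finite words avoid it. -/
def FAvoidable {V : Type*} (φ : Set (List (V × Bool))) : Prop :=
  ∃ A : Type, Finite A ∧ {w : List A | ¬ OccursIn φ w}.Infinite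

/-- The Zimin formulas with reversal `Z_{m,n}`, over the two-way variables
`Sum.inl i` (`i : Fin m`) and the one-way variables `Sum.inr j` (`j < n`):
`Z_{m,0} = x_1^♯ ⋯ x_m^♯` and `Z_{m,n} = Z_{m,n-1} y_n Z_{m,n-1}`. -/
def ZiminRev (m : ℕ) : ℕ → Set (List ((Fin m ⊕ ℕ) × Bool))
  | 0 => {p | ∃ b : Fin m → Bool, p = List.ofFn fun i => (Sum.inl i, b i)}
  | n + 1 => {p | ∃ u ∈ ZiminRev m n, ∃ v ∈ ZiminRev m n,
      p = u ++ [(Sum.inr n, false)] ++ v}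

/-- d-reversal: reverse a word over `Σ ∪ Σ^R` while swapping `x` with `x^R`. -/
def drev {V : Type*} (p : List (V × Bool)) : List (V × Bool) :=
  (p.map fun z => (z.1, !z.2)).reverse

/-- The image of a pattern with reversal under the d-reversal-respecting extension of `h`. -/
def applyDRev {V W : Type*} (h : V → List (W × Bool)) (p : List (V × Bool)) :
    List (W × Bool) :=
  p.flatMap fun z => if z.2 then drev (h z.1) else h z.1

/-- `φ` divides `ψ`: some non-erasing morphism respecting d-reversal sends
every fragment of `φ` to a factor of a fragment of `ψ`. -/
def FDivides {V W : Type*} (φ : Set (List (V × Bool))) (ψ : Set (List (W × Bool))) : Prop :=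
  ∃ h : V → List (W × Bool), NonErasing h ∧ ∀ p ∈ φ, ∃ q ∈ ψ, applyDRev h p <:+: q

/-- The letter `(x,b)` (i.e. `x` if `b = false`, `x^R` if `b = true`) appears in `φ`. -/
def Appears {V : Type*} (φ : Set (List (V × Bool))) (z : V × Bool) : Prop := ∃ p ∈ φ, z ∈ p

/-- `x` is a two-way variable of `φ`: both `x` and `x^R` appear in `φ`. -/
def TwoWay {V : Type*} (φ : Set (List (V × Bool))) (x : V) : Prop :=
  Appears φ (x, false) ∧ Appears φ (x, true)

/-- `x` is a one-way variable of `φ`: exactly one of `x`, `x^R` appears in `φ`. -/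
def OneWay {V : Type*} (φ : Set (List (V × Bool))) (x : V) : Prop :=
  (Appears φ (x, false) ∧ ¬ Appears φ (x, true)) ∨
  (Appears φ (x, true) ∧ ¬ Appears φ (x, false))

/-- The flattening of a pattern with reversal: forget all mirror images. -/
def flatten {V : Type*} (p : List (V × Bool)) : List V := p.map Prod.fst

/-- A finite word is a factor of an ω-word. -/
def InfFactor {A : Type*} (u : List A) (w : ℕ → A) : Prop :=
  ∃ i : ℕ, u = (List.range u.length).map fun j => w (i + j)

/-- A formula with reversal occurs in an ω-word. -/
def OccursInInf {V A : Type*} (φ : Set (List (V × Bool))) (w : ℕ → A) : Prop :=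
  ∃ h : V → List A, NonErasing h ∧ ∀ p ∈ φ, InfFactor (applyRev h p) w

/-- The image of a word (without reversal) under the extension of `h : Σ → A^*`. -/
def applyW {V A : Type*} (h : V → List A) (p : List V) : List A := p.flatMap h

/-- A formula without reversal occurs in a finite word. -/
def OccursInW {V A : Type*} (ψ : Set (List V)) (w : List A) : Prop :=
  ∃ h : V → List A, NonErasing h ∧ ∀ p ∈ ψ, applyW h p <:+: w

/-- A formula without reversal is avoidable. -/
def WAvoidable {V : Type*} (ψ : Set (List V)) : Prop :=
  ∃ A : Type, Finite A ∧ {w : List A | ¬ OccursInW ψ w}.Infinite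

/-- A word of length at least `2 ^ |V|` over `V` has a nonempty factor in which every letter
that occurs does so at least twice. -/
theorem exists_doubled_infix {V : Type*} [Fintype V] [DecidableEq V] (p : List (V × Bool))
    (hlen : 2 ^ Fintype.card V ≤ p.length) :
    ∃ q, q <:+: p ∧ q ≠ [] ∧ ∀ x ∈ q.map Prod.fst, 2 ≤ (q.map Prod.fst).count x := by
  let parity : Fin (p.length + 1) → V → ZMod 2 :=
    fun i x => (((p.take i).map Prod.fst).count x : ZMod 2)
  obtain ⟨i, j, hne, heq⟩ : ∃ i j, i ≠ j ∧ parity i = parity j := by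
    apply Fintype.exists_ne_map_eq_of_card_lt
    simp only [Fintype.card_pi, ZMod.card, Finset.prod_const, Finset.card_univ, Fintype.card_fin]
    omega
  wlog hij : i < j generalizing i j
  · exact this j i hne.symm heq.symm (lt_of_le_of_ne (not_lt.mp hij) hne.symm)
  have hij' : (i : ℕ) < j := hij
  have hj : (j : ℕ) ≤ p.length := Nat.lt_succ_iff.mp j.2
  have hsplit : p.take j = p.take i ++ (p.take j).drop i := by
    conv_lhs => rw [← List.take_append_drop i (p.take j)]
    rw [List.take_take, min_eq_left hij'.le]
  refine ⟨(p.take j).drop i, (List.drop_suffix _ _).isInfix.trans (List.take_prefix _ _).isInfix,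
    ?_, fun x hx => ?_⟩
  · intro h
    have := congrArg List.length h
    simp only [List.length_drop, List.length_take, List.length_nil] at this
    omega
  · have hpos := List.count_pos_iff.mpr hx
    have hx' := congrFun heq x
    simp only [parity] at hx'
    rw [hsplit, List.map_append, List.count_append, Nat.cast_add, left_eq_add,
      ZMod.natCast_eq_zero_iff] at hx'
    exact Nat.le_of_dvd hpos hx'

theorem length_applyRev {V A : Type*} (h : V → List A) (p : List (V × Bool)) :
    (applyRev h p).length = ((p.map Prod.fst).map fun x => (h x).length).sum := by
  simp only [applyRev, List.length_flatMap, List.map_map]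
  congr 1
  refine List.map_congr_left fun z _ => ?_
  by_cases hz : z.2 <;> simp [hz]

theorem applyRev_congr {V A : Type*} {h h' : V → List A} {p : List (V × Bool)}
    (H : ∀ x ∈ p.map Prod.fst, h x = h' x) : applyRev h p = applyRev h' p := by
  simp only [applyRev, List.flatMap]
  congr 1
  refine List.map_congr_left fun z hz => ?_
  rw [H z.1 (List.mem_map_of_mem hz)]

theorem two_mul_sum_length_le_length_applyRev {V A : Type*} [Fintype V] [DecidableEq V]
    {h : V → List A} {q : List (V × Bool)}
    (hq : ∀ x ∈ q.map Prod.fst, 2 ≤ (q.map Prod.fst).count x)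
    (hout : ∀ x, x ∉ q.map Prod.fst → h x = []) :
    2 * ∑ x, (h x).length ≤ (applyRev h q).length := by
  rw [length_applyRev, Finset.sum_list_map_count, Finset.mul_sum,
    ← Finset.sum_subset (Finset.subset_univ (q.map Prod.fst).toFinset)]
  · refine Finset.sum_le_sum fun x hx => ?_
    exact Nat.mul_le_mul_right _ (hq x (List.mem_toFinset.mp hx))
  · intro x _ hx
    simp [hout x (by rwa [List.mem_toFinset] at hx)]

theorem OccursIn.mono {V A : Type*} {φ : Set (List (V × Bool))} {u w : List A}
    (hu : OccursIn φ u) (huw : u <:+: w) : OccursIn φ w := by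
  obtain ⟨h, hne, hocc⟩ := hu
  exact ⟨h, hne, fun p hp => (hocc p hp).trans huw⟩

theorem OccursIn.of_infix {V A : Type*} {p q : List (V × Bool)} {w : List A}
    (hp : OccursIn {p} w) (hqp : q <:+: p) : OccursIn {q} w := by
  obtain ⟨h, hne, hocc⟩ := hp
  refine ⟨h, hne, ?_⟩
  rintro _ rfl
  refine List.IsInfix.trans ?_ (hocc p rfl)
  obtain ⟨s, t, rfl⟩ := hqp
  exact ⟨applyRev h s, applyRev h t, by simp [applyRev]⟩

theorem applyRev_ne_nil {V A : Type*} {h : V → List A} (hh : NonErasing h)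
    {q : List (V × Bool)} (hq : q ≠ []) : applyRev h q ≠ [] := by
  obtain ⟨z, t, rfl⟩ := List.exists_cons_of_ne_nil hq
  intro h0
  simp only [applyRev, List.flatMap_cons, List.append_eq_nil_iff] at h0
  have := h0.1
  split_ifs at this
  · exact hh _ (List.reverse_eq_nil_iff.mp this)
  · exact hh _ this

/-- The words of length `n` over an alphabet with eight letters. -/
noncomputable def wordsOfLength (n : ℕ) : Finset (List (Fin 8)) :=
  (List.finite_length_eq (Fin 8) n).toFinset

theorem mem_wordsOfLength {n : ℕ} {w : List (Fin 8)} : w ∈ wordsOfLength n ↔ w.length = n := by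
  simp [wordsOfLength]

theorem card_wordsOfLength (n : ℕ) : (wordsOfLength n).card = 8 ^ n := by
  have h := card_vector (α := Fin 8) n
  rw [Fintype.card_fin] at h
  rw [← h, ← Fintype.card_coe]
  exact Fintype.card_congr (Equiv.subtypeEquivRight fun _ => mem_wordsOfLength)

/-- The nonempty words of length at most `N` over an alphabet with eight letters. -/
noncomputable def nonemptyWordsUpTo (N : ℕ) : Finset (List (Fin 8)) :=
  (Finset.Icc 1 N).biUnion wordsOfLength

theorem mem_nonemptyWordsUpTo {N : ℕ} {w : List (Fin 8)} :
    w ∈ nonemptyWordsUpTo N ↔ w ≠ [] ∧ w.length ≤ N := by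
  simp [nonemptyWordsUpTo, mem_wordsOfLength, Nat.one_le_iff_ne_zero]

theorem sum_nonemptyWordsUpTo_le_one (N : ℕ) :
    ∑ w ∈ nonemptyWordsUpTo N, (1 / 16 : ℚ) ^ w.length ≤ 1 := by
  have hsum (N : ℕ) : ∑ s ∈ Finset.Icc 1 N, (1 / 2 : ℚ) ^ s = 1 - (1 / 2) ^ N := by
    induction N with
    | zero => simp
    | succ N ih => rw [Finset.sum_Icc_succ_top (by omega), ih]; ring
  rw [nonemptyWordsUpTo, Finset.sum_biUnion]
  · calc _ = ∑ s ∈ Finset.Icc 1 N, (1 / 2 : ℚ) ^ s := by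
          refine Finset.sum_congr rfl fun s _ => ?_
          rw [Finset.sum_congr rfl fun w hw => by rw [mem_wordsOfLength.mp hw],
            Finset.sum_const, card_wordsOfLength, nsmul_eq_mul, Nat.cast_pow, ← mul_pow]
          norm_num
      _ ≤ 1 := by
          rw [hsum]
          have : (0 : ℚ) ≤ (1 / 2) ^ N := by positivity
          linarith
  · intro a _ b _ hab
    refine Finset.disjoint_left.mpr fun w hwa hwb => hab ?_
    rw [← mem_wordsOfLength.mp hwa, mem_wordsOfLength.mp hwb]

open Classical in
/-- The words of length `n` over an alphabet with eight letters that avoid `q`. -/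
noncomputable def avoidingWords {V : Type*} (q : List (V × Bool)) (n : ℕ) :
    Finset (List (Fin 8)) :=
  (wordsOfLength n).filter fun w => ¬ OccursIn {q} w

theorem mem_avoidingWords {V : Type*} {q : List (V × Bool)} {n : ℕ} {w : List (Fin 8)} :
    w ∈ avoidingWords q n ↔ w.length = n ∧ ¬ OccursIn {q} w := by
  simp [avoidingWords, mem_wordsOfLength]

/-- The assignments of words of length at most `N` to the variables, nonempty exactly on the
variables of `q`. -/
noncomputable def assignments {V : Type*} [Fintype V] [DecidableEq V] (q : List (V × Bool))
    (N : ℕ) : Finset (V → List (Fin 8)) :=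
  Fintype.piFinset fun x => if x ∈ q.map Prod.fst then nonemptyWordsUpTo N else {[]}

theorem sum_assignments_le_one {V : Type*} [Fintype V] [DecidableEq V] (q : List (V × Bool))
    (N : ℕ) : ∑ h ∈ assignments q N, (1 / 16 : ℚ) ^ (∑ x, (h x).length) ≤ 1 := by
  simp only [← Finset.prod_pow_eq_pow_sum]
  rw [assignments, ← Finset.prod_univ_sum _ fun _ (w : List (Fin 8)) => (1 / 16 : ℚ) ^ w.length]
  refine Finset.prod_le_one (fun x _ => Finset.sum_nonneg fun w _ => by positivity) fun x _ => ?_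
  split_ifs
  · exact sum_nonemptyWordsUpTo_le_one N
  · simp

/-- A one-letter extension of a word avoiding `q` either avoids `q`, or ends with an instance of
`q` preceded by a word avoiding `q`. -/
theorem avoids_or_exists_suffix {V : Type*} [Fintype V] [DecidableEq V] {q : List (V × Bool)}
    (hq : q ≠ []) {n : ℕ} {w : List (Fin 8)} (hw : w ∈ avoidingWords q n) (a : Fin 8) :
    w ++ [a] ∈ avoidingWords q (n + 1) ∨
      ∃ h ∈ assignments q (n + 1), 1 ≤ (applyRev h q).length ∧
        (applyRev h q).length ≤ n + 1 ∧
        ∃ u ∈ avoidingWords q (n + 1 - (applyRev h q).length), u ++ applyRev h q = w ++ [a] := by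
  obtain ⟨hlen, havoid⟩ := mem_avoidingWords.mp hw
  by_cases hocc : OccursIn {q} (w ++ [a])
  swap
  · exact Or.inl (mem_avoidingWords.mpr ⟨by simp [hlen], hocc⟩)
  obtain ⟨h, hne, hinf⟩ := hocc
  rcases List.infix_concat_iff.mp (hinf q rfl) with hsuf | hinf'
  swap
  · exact absurd ⟨h, hne, by rintro _ rfl; exact hinf'⟩ havoid
  let h' : V → List (Fin 8) := fun x => if x ∈ q.map Prod.fst then h x else []
  have hh' : applyRev h' q = applyRev h q := applyRev_congr fun x hx => if_pos hx
  obtain ⟨u, hu⟩ := hsuf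
  have hulen := congrArg List.length hu
  simp only [List.length_append, List.length_singleton, hlen] at hulen
  have hpos : 1 ≤ (applyRev h q).length :=
    List.length_pos_iff.mpr (applyRev_ne_nil hne hq)
  refine Or.inr ⟨h', ?_, ?_⟩
  · refine Fintype.mem_piFinset.mpr fun x => ?_
    by_cases hx : x ∈ q.map Prod.fst
    · simp only [h', if_pos hx, mem_nonemptyWordsUpTo]
      refine ⟨hne x, le_trans ?_ (show (applyRev h q).length ≤ n + 1 by omega)⟩
      rw [length_applyRev]
      exact List.le_sum_of_mem (List.mem_map_of_mem (f := fun x => (h x).length) hx)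
    · simp only [h', if_neg hx, Finset.mem_singleton]
  · rw [hh']
    refine ⟨hpos, by omega, u, mem_avoidingWords.mpr ⟨by omega, fun hou => havoid ?_⟩, hu⟩
    refine hou.mono (List.IsPrefix.isInfix ?_)
    exact List.prefix_of_prefix_length_le ⟨_, hu⟩ (List.prefix_append w [a]) (by omega)

theorem four_mul_card_avoidingWords_le {V : Type*} [Fintype V] [DecidableEq V]
    {q : List (V × Bool)} (hne : q ≠ [])
    (hq : ∀ x ∈ q.map Prod.fst, 2 ≤ (q.map Prod.fst).count x) (n : ℕ) :
    4 * (avoidingWords q n).card ≤ (avoidingWords q (n + 1)).card := by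
  induction n using Nat.strong_induction_on with
  | _ n ih =>
  have hgrowth : ∀ d, d ≤ n →
      4 ^ d * (avoidingWords q (n - d)).card ≤ (avoidingWords q n).card := by
    intro d
    induction d with
    | zero => simp
    | succ d ihd =>
      intro hd
      have hstep := ih (n - (d + 1)) (by omega)
      rw [show n - (d + 1) + 1 = n - d by omega] at hstep
      calc _ = 4 ^ d * (4 * (avoidingWords q (n - (d + 1))).card) := by ring
        _ ≤ 4 ^ d * (avoidingWords q (n - d)).card := Nat.mul_le_mul_left _ hstep
        _ ≤ _ := ihd (by omega)
  let len : (V → List (Fin 8)) → ℕ := fun h => (applyRev h q).length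
  let H := (assignments q (n + 1)).filter fun h => 1 ≤ len h ∧ len h ≤ n + 1
  have hcover : ((avoidingWords q n) ×ˢ (Finset.univ : Finset (Fin 8))).image
      (fun z => z.1 ++ [z.2]) ⊆ avoidingWords q (n + 1) ∪
        H.biUnion fun h => (avoidingWords q (n + 1 - len h)).image (· ++ applyRev h q) := by
    intro v hv
    simp only [Finset.mem_image, Finset.mem_product, Finset.mem_univ, and_true] at hv
    obtain ⟨⟨w, a⟩, hw, rfl⟩ := hv
    rcases avoids_or_exists_suffix hne hw a with hmem | ⟨h, hh, h1, h2, u, hu, huw⟩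
    · exact Finset.mem_union_left _ hmem
    · exact Finset.mem_union_right _ (Finset.mem_biUnion.mpr
        ⟨h, Finset.mem_filter.mpr ⟨hh, h1, h2⟩, Finset.mem_image.mpr ⟨u, hu, huw⟩⟩)
  have hcard : (avoidingWords q n).card * 8 ≤ (avoidingWords q (n + 1)).card +
      ∑ h ∈ H, (avoidingWords q (n + 1 - len h)).card := by
    have hle := Finset.card_le_card hcover
    rw [Finset.card_image_of_injective, Finset.card_product, Finset.card_univ,
      Fintype.card_fin] at hle
    · refine hle.trans ((Finset.card_union_le _ _).trans (Nat.add_le_add_left ?_ _))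
      exact Finset.card_biUnion_le.trans (Finset.sum_le_sum fun h _ => Finset.card_image_le)
    · rintro ⟨w, a⟩ ⟨w', a'⟩ heq
      have := List.append_inj' heq rfl
      simp_all
  have hbad : (∑ h ∈ H, ((avoidingWords q (n + 1 - len h)).card : ℚ)) ≤
      4 * (avoidingWords q n).card := by
    calc _ ≤ ∑ h ∈ H, 4 * ((avoidingWords q n).card : ℚ) *
            (1 / 16 : ℚ) ^ (∑ x, (h x).length) := by
          refine Finset.sum_le_sum fun h hh => ?_
          obtain ⟨hmem, h1, h2⟩ := Finset.mem_filter.mp hh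
          have hdouble : 2 * ∑ x, (h x).length ≤ len h := by
            refine two_mul_sum_length_le_length_applyRev hq fun x hx => ?_
            have := Fintype.mem_piFinset.mp hmem x
            rwa [if_neg hx, Finset.mem_singleton] at this
          have hg := hgrowth (len h - 1) (by omega)
          rw [show n - (len h - 1) = n + 1 - len h by omega] at hg
          have hnat : 16 ^ (∑ x, (h x).length) * (avoidingWords q (n + 1 - len h)).card ≤
              4 * (avoidingWords q n).card := by
            calc _ ≤ 4 ^ len h * (avoidingWords q (n + 1 - len h)).card := by
                  refine Nat.mul_le_mul_right _ ?_
                  rw [show 16 = 4 ^ 2 by norm_num, ← pow_mul]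
                  exact Nat.pow_le_pow_right (by norm_num) hdouble
              _ = 4 * (4 ^ (len h - 1) * (avoidingWords q (n + 1 - len h)).card) := by
                  conv_lhs => rw [show len h = len h - 1 + 1 by omega, pow_succ]
                  rw [show len h - 1 + 1 = len h by omega]
                  ring
              _ ≤ _ := Nat.mul_le_mul_left _ hg
          have hrat : (16 : ℚ) ^ (∑ x, (h x).length) * (avoidingWords q (n + 1 - len h)).card ≤
              4 * (avoidingWords q n).card := by exact_mod_cast hnat
          rw [one_div, inv_pow, ← div_eq_mul_inv, le_div_iff₀ (by positivity), mul_comm]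
          exact hrat
      _ ≤ ∑ h ∈ assignments q (n + 1), 4 * ((avoidingWords q n).card : ℚ) *
            (1 / 16 : ℚ) ^ (∑ x, (h x).length) :=
          Finset.sum_le_sum_of_subset_of_nonneg (Finset.filter_subset _ _)
            fun _ _ _ => by positivity
      _ ≤ 4 * (avoidingWords q n).card := by
          rw [← Finset.mul_sum]
          exact mul_le_of_le_one_right (by positivity) (sum_assignments_le_one q (n + 1))
  have hbad' : ∑ h ∈ H, (avoidingWords q (n + 1 - len h)).card ≤
      4 * (avoidingWords q n).card := by exact_mod_cast hbad
  omega

theorem avoidingWords_nonempty {V : Type*} [Fintype V] [DecidableEq V]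
    {q : List (V × Bool)} (hne : q ≠ [])
    (hq : ∀ x ∈ q.map Prod.fst, 2 ≤ (q.map Prod.fst).count x) (n : ℕ) :
    (avoidingWords q n).Nonempty := by
  induction n with
  | zero =>
    refine ⟨[], mem_avoidingWords.mpr ⟨rfl, ?_⟩⟩
    rintro ⟨h, hh, hocc⟩
    exact applyRev_ne_nil hh hne (List.infix_nil.mp (hocc q rfl))
  | succ n ih =>
    rw [← Finset.card_pos] at ih ⊢
    have := four_mul_card_avoidingWords_le hne hq n
    omega

/-- A pattern with reversal over an alphabet of exactly `n`
variables whose length is at least `2^n` is avoidable. -/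
theorem avoidable_of_length_ge_two_pow {V : Type*} [Fintype V] (n : ℕ)
    (hcard : Fintype.card V = n) (p : List (V × Bool)) (hp : p ≠ [])
    (hlen : 2 ^ n ≤ p.length) : FAvoidable {p} := by
  classical
  subst hcard
  obtain ⟨q, hqp, hne, hq⟩ := exists_doubled_infix p hlen
  refine ⟨Fin 8, inferInstance, ?_⟩
  refine Set.Infinite.of_image List.length (Set.infinite_univ.mono fun n _ => ?_)
  obtain ⟨w, hw⟩ := avoidingWords_nonempty hne hq n
  obtain ⟨hwlen, havoid⟩ := mem_avoidingWords.mp hw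
  exact ⟨w, fun hocc => havoid (hocc.of_infix hqp), hwlen⟩
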